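/- arXiv:0804.4310 — 2 statements merged into one kernel-verified Lean document; each statement's English description precedes it below -/
import Mathlib

section
/- Let a < b be real numbers and let f : [a,b] → ℝ be continuous on [a,b] and differentiable on (a,b) with |f'(s)| ≤ M for all s ∈ (a,b). Then for every t ∈ [(5a+b)/6, (a+5b)/6], |(f(a) + 4f(t) + f(b))/6 − (1/(b−a))·∫_a^b f(s) ds| ≤ M·( 5(b−a)/36 + (1/(b−a))·(t − (a+b)/2)² ). -/
theorem abs_sub_le_of_hasDerivAt_Ioo {a b M : ℝ} {f f' : ℝ → ℝ}
    (hcont : ContinuousOn f (Set.Icc a b))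
    (hderiv : ∀ s ∈ Set.Ioo a b, HasDerivAt f (f' s) s)
    (hbound : ∀ s ∈ Set.Ioo a b, |f' s| ≤ M) {x y : ℝ}
    (hx : x ∈ Set.Icc a b) (hy : y ∈ Set.Icc a b) :
    |f x - f y| ≤ M * |x - y| := by
  wlog hxy : x ≤ y generalizing x y
  · rw [abs_sub_comm (f x), abs_sub_comm x]
    exact this hy hx (le_of_not_ge hxy)
  rcases hxy.eq_or_lt with rfl | hlt
  · simp
  obtain ⟨c, hc, h⟩ := exists_hasDerivAt_eq_slope f f' hlt
    (hcont.mono (Set.Icc_subset_Icc hx.1 hy.2))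
    fun s hs ↦ hderiv s (Set.Ioo_subset_Ioo hx.1 hy.2 hs)
  rw [eq_div_iff (sub_pos.2 hlt).ne'] at h
  rw [abs_sub_comm (f x), abs_sub_comm x, ← h, abs_mul]
  exact mul_le_mul_of_nonneg_right (hbound c (Set.Ioo_subset_Ioo hx.1 hy.2 hc)) (abs_nonneg _)

theorem integral_abs_sub_of_mem_Icc {p q x : ℝ} (hx : x ∈ Set.Icc p q) :
    ∫ s in p..q, |x - s| = ((x - p) ^ 2 + (q - x) ^ 2) / 2 := by
  have hint : ∀ u v : ℝ, IntervalIntegrable (fun s ↦ |x - s|) MeasureTheory.volume u v :=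
    fun u v ↦ Continuous.intervalIntegrable (by fun_prop) u v
  have hleft : ∫ s in p..x, |x - s| = ∫ s in p..x, (x - s) := by
    refine intervalIntegral.integral_congr fun s hs ↦ ?_
    rw [Set.uIcc_of_le hx.1] at hs
    exact abs_of_nonneg (sub_nonneg.2 hs.2)
  have hright : ∫ s in x..q, |x - s| = ∫ s in x..q, (s - x) := by
    refine intervalIntegral.integral_congr fun s hs ↦ ?_
    rw [Set.uIcc_of_le hx.2] at hs
    exact (abs_sub_comm x s).trans (abs_of_nonneg (sub_nonneg.2 hs.1))
  rw [← intervalIntegral.integral_add_adjacent_intervals (hint p x) (hint x q), hleft, hright,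
    intervalIntegral.integral_sub (by simp) (by simp),
    intervalIntegral.integral_sub (by simp) (by simp)]
  simp only [intervalIntegral.integral_const, integral_id, smul_eq_mul]
  ring

/-- Ostrowski's inequality for a function with a Lipschitz estimate at `x`. -/
theorem abs_mul_sub_integral_le {p q x M : ℝ} {f : ℝ → ℝ} (hx : x ∈ Set.Icc p q)
    (hf : IntervalIntegrable f MeasureTheory.volume p q)
    (hM : ∀ s ∈ Set.Icc p q, |f x - f s| ≤ M * |x - s|) :
    |(q - p) * f x - ∫ s in p..q, f s| ≤ M * (((x - p) ^ 2 + (q - x) ^ 2) / 2) := by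
  have hpq : p ≤ q := hx.1.trans hx.2
  have heq : (q - p) * f x - ∫ s in p..q, f s = ∫ s in p..q, (f x - f s) := by
    rw [intervalIntegral.integral_sub (by simp) hf, intervalIntegral.integral_const, smul_eq_mul]
  rw [heq, ← integral_abs_sub_of_mem_Icc hx, ← intervalIntegral.integral_const_mul,
    ← Real.norm_eq_abs]
  refine intervalIntegral.norm_integral_le_of_norm_le hpq
    (Filter.Eventually.of_forall fun s hs ↦ hM s (Set.Ioc_subset_Icc_self hs))
    (Continuous.intervalIntegrable (by fun_prop) p q)



/-- Parametrized Simpson-type inequality on the real line. -/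
theorem simpson_type_inequality (a b M : ℝ) (hab : a < b) (f f' : ℝ → ℝ)
    (hcont : ContinuousOn f (Set.Icc a b))
    (hderiv : ∀ s ∈ Set.Ioo a b, HasDerivAt f (f' s) s)
    (hbound : ∀ s ∈ Set.Ioo a b, |f' s| ≤ M)
    (t : ℝ) (ht : t ∈ Set.Icc ((5 * a + b) / 6) ((a + 5 * b) / 6)) :
    |(f a + 4 * f t + f b) / 6 - (1 / (b - a)) * ∫ s in a..b, f s| ≤
      M * (5 * (b - a) / 36 + (1 / (b - a)) * (t - (a + b) / 2) ^ 2) := by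
  obtain ⟨ht₁, ht₂⟩ := ht
  set c := (5 * a + b) / 6 with hc
  set d := (a + 5 * b) / 6 with hd
  have hac : a ≤ c := by linarith
  have hcd : c ≤ d := ht₁.trans ht₂
  have hdb : d ≤ b := by linarith
  have hint : ∀ {u v : ℝ}, a ≤ u → u ≤ v → v ≤ b →
      IntervalIntegrable f MeasureTheory.volume u v := fun hu huv hv ↦
    (hcont.mono (Set.Icc_subset_Icc hu hv)).intervalIntegrable_of_Icc huv
  have key : ∀ {p q x : ℝ}, a ≤ p → q ≤ b → x ∈ Set.Icc p q →
      |(q - p) * f x - ∫ s in p..q, f s| ≤ M * (((x - p) ^ 2 + (q - x) ^ 2) / 2) :=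
    fun hp hq hx ↦ abs_mul_sub_integral_le hx (hint hp (hx.1.trans hx.2) hq) fun s hs ↦
      abs_sub_le_of_hasDerivAt_Ioo hcont hderiv hbound
        (Set.Icc_subset_Icc hp hq hx) (Set.Icc_subset_Icc hp hq hs)
  have hleft := key le_rfl (hcd.trans hdb) (Set.left_mem_Icc.2 hac)
  have hmid := key hac hdb ⟨ht₁, ht₂⟩
  have hright := key (hac.trans hcd) le_rfl (Set.right_mem_Icc.2 hdb)
  have hsplit : ∫ s in a..b, f s =
      (∫ s in a..c, f s) + (∫ s in c..d, f s) + ∫ s in d..b, f s := by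
    rw [intervalIntegral.integral_add_adjacent_intervals (hint le_rfl hac (hcd.trans hdb))
        (hint hac hcd hdb),
      intervalIntegral.integral_add_adjacent_intervals (hint le_rfl (hac.trans hcd) hdb)
        (hint (hac.trans hcd) hdb le_rfl)]
  have hba : 0 < b - a := sub_pos.2 hab
  have heq : (f a + 4 * f t + f b) / 6 - (1 / (b - a)) * ∫ s in a..b, f s =
      (((c - a) * f a - ∫ s in a..c, f s) + ((d - c) * f t - ∫ s in c..d, f s) +
        ((b - d) * f b - ∫ s in d..b, f s)) / (b - a) := by
    rw [hsplit, eq_div_iff hba.ne', sub_mul, mul_right_comm, one_div_mul_cancel hba.ne', hc, hd]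
    ring
  have hrhs : M * (5 * (b - a) / 36 + (1 / (b - a)) * (t - (a + b) / 2) ^ 2) =
      (M * (((a - a) ^ 2 + (c - a) ^ 2) / 2) + M * (((t - c) ^ 2 + (d - t) ^ 2) / 2) +
        M * (((b - d) ^ 2 + (b - b) ^ 2) / 2)) / (b - a) := by
    rw [eq_div_iff hba.ne', mul_assoc, add_mul, mul_right_comm (1 / (b - a)),
      one_div_mul_cancel hba.ne', hc, hd]
    ring
  rw [heq, hrhs, abs_div, abs_of_pos hba]
  gcongr
  exact (abs_add_three _ _ _).trans (add_le_add_three hleft hmid hright)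
end

section
/- Let a < b be real numbers and let f : [a,b] → ℝ be continuous on [a,b] and differentiable on (a,b) with |f'(s)| ≤ M for all s ∈ (a,b). Then for every t ∈ [(3a+b)/4, (a+3b)/4], |(1/2)·((f(a)+f(b))/2 + f(t)) − (1/(b−a))·∫_a^b f(s) ds| ≤ M·( (b−a)/8 + (1/(b−a))·(t − (a+b)/2)² ). -/
theorem abs_sub_le_of_abs_hasDerivAt_le {a b M : ℝ} {f f' : ℝ → ℝ}
    (hcont : ContinuousOn f (Set.Icc a b))
    (hderiv : ∀ s ∈ Set.Ioo a b, HasDerivAt f (f' s) s)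
    (hbound : ∀ s ∈ Set.Ioo a b, |f' s| ≤ M)
    {x y : ℝ} (hx : x ∈ Set.Icc a b) (hy : y ∈ Set.Icc a b) (hxy : x ≤ y) :
    |f y - f x| ≤ M * (y - x) := by
  rcases hxy.eq_or_lt with rfl | hlt
  · simp
  · obtain ⟨c, hc, hslope⟩ := exists_hasDerivAt_eq_slope f f' hlt
      (hcont.mono (Set.Icc_subset_Icc hx.1 hy.2))
      (fun s hs => hderiv s ⟨hx.1.trans_lt hs.1, hs.2.trans_le hy.2⟩)
    have hpos : 0 < y - x := sub_pos.2 hlt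
    have heq : f y - f x = f' c * (y - x) := by
      rw [hslope]
      field_simp
    rw [heq, abs_mul, abs_of_pos hpos]
    exact mul_le_mul_of_nonneg_right
      (hbound c ⟨hx.1.trans_lt hc.1, hc.2.trans_le hy.2⟩) hpos.le

/-- The left-endpoint rectangle rule for a function with Lipschitz bound `M` at the left
endpoint. -/
theorem abs_integral_sub_left_rectangle_le {c d M : ℝ} {f : ℝ → ℝ} (hcd : c ≤ d)
    (hf : IntervalIntegrable f MeasureTheory.volume c d)
    (hlip : ∀ s ∈ Set.Icc c d, |f s - f c| ≤ M * (s - c)) :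
    |(∫ s in c..d, f s) - (d - c) * f c| ≤ M * (d - c) ^ 2 / 2 := by
  have heq : (∫ s in c..d, f s) - (d - c) * f c = ∫ s in c..d, (f s - f c) := by
    rw [intervalIntegral.integral_sub hf (by simp)]
    simp
  have hint : ∫ s in c..d, M * (s - c) = M * (d - c) ^ 2 / 2 := by
    rw [intervalIntegral.integral_const_mul, intervalIntegral.integral_sub (by simp) (by simp)]
    simp only [integral_id, intervalIntegral.integral_const, smul_eq_mul]
    ring
  rw [heq, ← hint, ← Real.norm_eq_abs]
  exact intervalIntegral.norm_integral_le_of_norm_le hcd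
    (Filter.Eventually.of_forall fun s hs => hlip s (Set.Ioc_subset_Icc_self hs))
    (Continuous.intervalIntegrable (by fun_prop) _ _)

/-- The right-endpoint rectangle rule for a function with Lipschitz bound `M` at the right
endpoint. -/
theorem abs_integral_sub_right_rectangle_le {c d M : ℝ} {f : ℝ → ℝ} (hcd : c ≤ d)
    (hf : IntervalIntegrable f MeasureTheory.volume c d)
    (hlip : ∀ s ∈ Set.Icc c d, |f d - f s| ≤ M * (d - s)) :
    |(∫ s in c..d, f s) - (d - c) * f d| ≤ M * (d - c) ^ 2 / 2 := by
  have heq : (∫ s in c..d, f s) - (d - c) * f d = ∫ s in c..d, (f s - f d) := by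
    rw [intervalIntegral.integral_sub hf (by simp)]
    simp
  have hint : ∫ s in c..d, M * (d - s) = M * (d - c) ^ 2 / 2 := by
    rw [intervalIntegral.integral_const_mul, intervalIntegral.integral_sub (by simp) (by simp)]
    simp only [integral_id, intervalIntegral.integral_const, smul_eq_mul]
    ring
  rw [heq, ← hint, ← Real.norm_eq_abs]
  refine intervalIntegral.norm_integral_le_of_norm_le hcd
    (Filter.Eventually.of_forall fun s hs => ?_)
    (Continuous.intervalIntegrable (by fun_prop) _ _)
  rw [Real.norm_eq_abs, abs_sub_comm]
  exact hlip s (Set.Ioc_subset_Icc_self hs)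

/-- Parametrized averaged midpoint–trapezoid type inequality on the real line. -/
theorem averaged_midpoint_trapezoid_type_inequality (a b M : ℝ) (hab : a < b)
    (f f' : ℝ → ℝ)
    (hcont : ContinuousOn f (Set.Icc a b))
    (hderiv : ∀ s ∈ Set.Ioo a b, HasDerivAt f (f' s) s)
    (hbound : ∀ s ∈ Set.Ioo a b, |f' s| ≤ M)
    (t : ℝ) (ht : t ∈ Set.Icc ((3 * a + b) / 4) ((a + 3 * b) / 4)) :
    |(1 / 2) * ((f a + f b) / 2 + f t) - (1 / (b - a)) * ∫ s in a..b, f s| ≤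
      M * ((b - a) / 8 + (1 / (b - a)) * (t - (a + b) / 2) ^ 2) := by
  obtain ⟨hpt, htq⟩ := ht
  obtain ⟨p, hp⟩ : ∃ p, p = (3 * a + b) / 4 := ⟨_, rfl⟩
  obtain ⟨q, hq⟩ : ∃ q, q = (a + 3 * b) / 4 := ⟨_, rfl⟩
  rw [← hp] at hpt
  rw [← hq] at htq
  have hap : a ≤ p := by linarith
  have hqb : q ≤ b := by linarith
  have hlip {x y : ℝ} (hax : a ≤ x) (hxy : x ≤ y) (hyb : y ≤ b) :
      |f y - f x| ≤ M * (y - x) :=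
    abs_sub_le_of_abs_hasDerivAt_le hcont hderiv hbound
      ⟨hax, hxy.trans hyb⟩ ⟨hax.trans hxy, hyb⟩ hxy
  have hii {x y : ℝ} (hax : a ≤ x) (hxy : x ≤ y) (hyb : y ≤ b) :
      IntervalIntegrable f MeasureTheory.volume x y :=
    (hcont.mono (Set.Icc_subset_Icc hax hyb)).intervalIntegrable_of_Icc hxy
  have iap := hii le_rfl hap (by linarith)
  have ipt := hii hap hpt (by linarith)
  have itq := hii (by linarith) htq hqb
  have iqb := hii (by linarith) hqb le_rfl
  have hsplit : ∫ s in a..b, f s =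
      (∫ s in a..p, f s) + (∫ s in p..t, f s) + (∫ s in t..q, f s) + ∫ s in q..b, f s := by
    rw [intervalIntegral.integral_add_adjacent_intervals iap ipt,
      intervalIntegral.integral_add_adjacent_intervals (iap.trans ipt) itq,
      intervalIntegral.integral_add_adjacent_intervals ((iap.trans ipt).trans itq) iqb]
  have eap := abs_le.1 <| abs_integral_sub_left_rectangle_le hap iap
    fun s hs => hlip le_rfl hs.1 (by linarith [hs.2])
  have ept := abs_le.1 <| abs_integral_sub_right_rectangle_le hpt ipt
    fun s hs => hlip (by linarith [hs.1]) hs.2 (by linarith)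
  have etq := abs_le.1 <| abs_integral_sub_left_rectangle_le htq itq
    fun s hs => hlip (by linarith) hs.1 (by linarith [hs.2])
  have eqb := abs_le.1 <| abs_integral_sub_right_rectangle_le hqb iqb
    fun s hs => hlip (by linarith [hs.1]) hs.2 le_rfl
  have hpos : 0 < b - a := sub_pos.2 hab
  have hL : (1 / 2) * ((f a + f b) / 2 + f t) - (1 / (b - a)) * ∫ s in a..b, f s =
      ((b - a) * ((f a + f b) / 4 + f t / 2) - ∫ s in a..b, f s) / (b - a) := by
    field_simp
    ring
  have hR : M * ((b - a) / 8 + (1 / (b - a)) * (t - (a + b) / 2) ^ 2) =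
      (M * ((b - a) ^ 2 / 8 + (t - (a + b) / 2) ^ 2)) / (b - a) := by
    field_simp
  rw [hL, hR, abs_div, abs_of_pos hpos]
  refine div_le_div_of_nonneg_right ?_ hpos.le
  rw [hsplit, abs_le]
  subst hp hq
  constructor <;> linarith [eap.1, eap.2, ept.1, ept.2, etq.1, etq.2, eqb.1, eqb.2]
end
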